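/- (Koopman decomposition of the kinetic energy.) Let u₀ ∈ ω_B and t ≥ 0, and let u(t,·) = −2 ∂ₓv(t,·)/v(t,·) be the Burgers evolution of u₀. Then the family ( e^{(λ_ν + λ_{ν'}) t} φ_ν(u₀) φ_{ν'}(u₀) ∫₀¹ a_ν(s) a_{ν'}(s) ds )_{(ν,ν') ∈ 𝒜 × 𝒜} is summable and its sum equals the kinetic energy E(u(t,·)) = ∫₀¹ u(t,s)² ds. -/

import Mathlib

open MeasureTheory Real Set

/-- The `L²([0,1])` norm of a real function. -/
noncomputable def L2norm (f : ℝ → ℝ) : ℝ := Real.sqrt (∫ s in (0:ℝ)..1, f s ^ 2)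

/-- The Cole-Hopf transform `H`. -/
noncomputable def coleHopfH (u : ℝ → ℝ) : ℝ → ℝ := fun x =>
  Real.exp (-(1/2) * ∫ s in (0:ℝ)..x, u s) /
    ∫ y in (0:ℝ)..1, Real.exp (-(1/2) * ∫ s in (0:ℝ)..y, u s)

/-- The cosine Fourier coefficient `cₙ(v) = √2 ∫₀¹ v(s) cos(nπs) ds`. -/
noncomputable def cCoef (n : ℕ) (v : ℝ → ℝ) : ℝ :=
  Real.sqrt 2 * ∫ s in (0:ℝ)..1, v s * Real.cos (n * π * s)

/-- `lₙ(u) = cₙ(H(u))`. -/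
noncomputable def lCoef (n : ℕ) (u : ℝ → ℝ) : ℝ := cCoef n (coleHopfH u)

/-- `u₀ ∈ Ω_B` : `u₀ ∈ L²([0,1])` with `2 e^{‖u₀‖} ‖u₀‖ < 1`. -/
def MemOmegaB (u₀ : ℝ → ℝ) : Prop :=
  IntervalIntegrable u₀ volume 0 1 ∧ IntervalIntegrable (fun s => u₀ s ^ 2) volume 0 1 ∧
    2 * Real.exp (L2norm u₀) * L2norm u₀ < 1

/-- The heat evolution `v(t,x) = 1 + Σ_{n≥1} e^{-n²π²t} lₙ(u₀) √2 cos(nπx)`. -/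
noncomputable def heatV (u₀ : ℝ → ℝ) (t x : ℝ) : ℝ :=
  1 + ∑' n : ℕ+, Real.exp (-((n : ℕ) : ℝ) ^ 2 * π ^ 2 * t) * lCoef (n : ℕ) u₀ *
    (Real.sqrt 2 * Real.cos (((n : ℕ) : ℝ) * π * x))

/-- The spatial derivative of the heat evolution,
`∂ₓv(t,x) = -Σ_{n≥1} e^{-n²π²t} lₙ(u₀) √2 nπ sin(nπx)`. -/
noncomputable def heatVx (u₀ : ℝ → ℝ) (t x : ℝ) : ℝ :=
  -∑' n : ℕ+, Real.exp (-((n : ℕ) : ℝ) ^ 2 * π ^ 2 * t) * lCoef (n : ℕ) u₀ *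
    (Real.sqrt 2 * ((n : ℕ) : ℝ) * π * Real.sin (((n : ℕ) : ℝ) * π * x))

/-- The Burgers evolution `u(t,x) = -2 ∂ₓv(t,x) / v(t,x)`. -/
noncomputable def burgersU (u₀ : ℝ → ℝ) (t x : ℝ) : ℝ := -2 * heatVx u₀ t x / heatV u₀ t x

/-- The Koopman index set `𝒜`: a tuple `ν = (n₀, n₁, …, n_{α(ν)})` of positive integers,
encoded as the head `n₀ : ℕ+` together with the (possibly empty) list `(n₁, …, n_{α(ν)})`. -/
abbrev KoopIdx : Type := ℕ+ × List ℕ+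

/-- The Koopman eigenvalue `λ_ν = -π² Σ_{k=0}^{α(ν)} n_k²`. -/
noncomputable def lamIdx (ν : KoopIdx) : ℝ :=
  -π ^ 2 * ((((ν.1 : ℕ) : ℝ)) ^ 2 + (ν.2.map (fun k => (((k : ℕ) : ℝ)) ^ 2)).sum)

/-- The Koopman mode
`a_ν(x) = (-1)^{α(ν)} 2^{(α(ν)+3)/2} n₀ π sin(n₀πx) ∏_{k=1}^{α(ν)} cos(n_kπx)`. -/
noncomputable def aIdx (ν : KoopIdx) (x : ℝ) : ℝ :=
  (-1 : ℝ) ^ ν.2.length * (2 : ℝ) ^ (((ν.2.length : ℝ) + 3) / 2) * ((ν.1 : ℕ) : ℝ) * π *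
    Real.sin (((ν.1 : ℕ) : ℝ) * π * x) *
    (ν.2.map (fun k => Real.cos (((k : ℕ) : ℝ) * π * x))).prod

/-- The Koopman eigenfunctional `φ_ν(u₀) = ∏_{k=0}^{α(ν)} l_{n_k}(u₀)`. -/
noncomputable def phiIdx (u₀ : ℝ → ℝ) (ν : KoopIdx) : ℝ :=
  lCoef (ν.1 : ℕ) u₀ * (ν.2.map (fun k => lCoef (k : ℕ) u₀)).prod


lemma kd_tuple {b : ℕ+ → ℝ} (hb : Summable (fun n => |b n|)) (n : ℕ) :
    Summable (fun f : Fin n → ℕ+ => |∏ i, b (f i)|) ∧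
      ∑' f : Fin n → ℕ+, ∏ i, b (f i) = (∑' n, b n) ^ n := by
  induction n with
  | zero =>
    refine ⟨(hasSum_fintype _).summable, ?_⟩
    simp [tsum_fintype]
  | succ n ih =>
    obtain ⟨h1, h2⟩ := ih
    have key : ∀ p : ℕ+ × (Fin n → ℕ+),
        ∏ i, b ((Fin.consEquiv (fun _ => ℕ+)) p i) = b p.1 * ∏ i, b (p.2 i) := by
      intro p
      simp [Fin.consEquiv, Fin.prod_univ_succ]
    constructor
    · rw [← (Fin.consEquiv (fun _ : Fin (n+1) => ℕ+)).summable_iff]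
      have := Summable.mul_of_nonneg hb h1 (fun _ => abs_nonneg _) (fun _ => abs_nonneg _)
      refine this.congr (fun p => ?_)
      simp only [Function.comp]
      rw [key, abs_mul]
    · rw [← (Fin.consEquiv (fun _ : Fin (n+1) => ℕ+)).tsum_eq]
      simp_rw [key]
      have hb' : Summable (fun n => ‖b n‖) := hb
      have h1' : Summable (fun f : Fin n → ℕ+ => ‖∏ i, b (f i)‖) := h1
      rw [← tsum_mul_tsum_of_summable_norm hb' h1', h2, pow_succ']

lemma kd_list {b : ℕ+ → ℝ} (hb : Summable (fun n => |b n|)) (hlt : ∑' n, |b n| < 1) :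
    Summable (fun l : List ℕ+ => |(l.map b).prod|) ∧
      HasSum (fun l : List ℕ+ => (l.map b).prod) (1 - ∑' n, b n)⁻¹ := by
  have habs : Summable (fun n => |(|b n|)|) := by simpa using hb
  have hr0 : 0 ≤ ∑' n, |b n| := tsum_nonneg (fun _ => abs_nonneg _)
  have key : ∀ p : (Σ n, Fin n → ℕ+),
      ((List.equivSigmaTuple.symm p).map b).prod = ∏ i, b (p.2 i) := by
    rintro ⟨n, f⟩
    simp [List.equivSigmaTuple, List.prod_ofFn, List.map_ofFn]
  have hS : Summable (fun p : (Σ n, Fin n → ℕ+) => |∏ i, b (p.2 i)|) := by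
    rw [summable_sigma_of_nonneg (fun _ => abs_nonneg _)]
    refine ⟨fun n => (kd_tuple hb n).1, ?_⟩
    have : ∀ n, ∑' f : Fin n → ℕ+, |∏ i, b (f i)| = (∑' n, |b n|) ^ n := by
      intro n
      rw [← (kd_tuple habs n).2]
      simp_rw [Finset.abs_prod]
    simp only [this]
    exact summable_geometric_of_lt_one hr0 hlt
  have hL : Summable (fun l : List ℕ+ => |(l.map b).prod|) := by
    rw [← List.equivSigmaTuple.symm.summable_iff]
    refine hS.congr (fun p => ?_)
    simp only [Function.comp]
    rw [key]
  refine ⟨hL, ?_⟩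
  have hL' := hL.of_abs
  have : ∑' l : List ℕ+, (l.map b).prod = (1 - ∑' n, b n)⁻¹ := by
    rw [← List.equivSigmaTuple.symm.tsum_eq]
    simp_rw [key]
    rw [hS.of_abs.tsum_sigma]
    simp_rw [(kd_tuple hb _).2]
    apply tsum_geometric_of_abs_lt_one
    have h2 : Summable (fun n => ‖b n‖) := hb
    exact lt_of_le_of_lt (norm_tsum_le_tsum_norm h2) hlt
  rw [← this]
  exact hL'.hasSum

lemma kd_bessel (e : ℕ+ → ℝ → ℝ) (he : ∀ n, Continuous (e n))
    (horth : ∀ n m, ∫ s in (0:ℝ)..1, e n s * e m s = if n = m then 1 else 0)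
    (f : ℝ → ℝ) (hf : IntervalIntegrable f volume 0 1)
    (hf2 : IntervalIntegrable (fun s => f s ^ 2) volume 0 1) (S : Finset ℕ+) :
    ∑ n ∈ S, (∫ s in (0:ℝ)..1, f s * e n s) ^ 2 ≤ ∫ s in (0:ℝ)..1, f s ^ 2 := by
  set c : ℕ+ → ℝ := fun n => ∫ s in (0:ℝ)..1, f s * e n s with hc
  set g : ℝ → ℝ := fun s => ∑ n ∈ S, c n * e n s with hg
  have hgc : Continuous g := by
    apply continuous_finsetSum
    intro n _
    exact continuous_const.mul (he n)
  have hfe : ∀ n, IntervalIntegrable (fun s => f s * e n s) volume 0 1 :=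
    fun n => hf.mul_continuousOn (he n).continuousOn
  have hfg : IntervalIntegrable (fun s => f s * g s) volume 0 1 :=
    hf.mul_continuousOn hgc.continuousOn
  have hg2 : IntervalIntegrable (fun s => g s ^ 2) volume 0 1 :=
    (hgc.pow 2).intervalIntegrable _ _
  have h1 : ∫ s in (0:ℝ)..1, f s * g s = ∑ n ∈ S, c n ^ 2 := by
    have : ∀ s, f s * g s = ∑ n ∈ S, c n * (f s * e n s) := by
      intro s
      simp only [hg, Finset.mul_sum]
      exact Finset.sum_congr rfl (fun _ _ => by ring)
    simp_rw [this]
    rw [intervalIntegral.integral_finsetSum (fun n _ => (hfe n).const_mul _)]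
    refine Finset.sum_congr rfl (fun n _ => ?_)
    rw [intervalIntegral.integral_const_mul]
    ring
  have h2 : ∫ s in (0:ℝ)..1, g s ^ 2 = ∑ n ∈ S, c n ^ 2 := by
    have : ∀ s, g s ^ 2 = ∑ n ∈ S, ∑ m ∈ S, c n * c m * (e n s * e m s) := by
      intro s
      simp only [hg, sq, Finset.sum_mul_sum]
      exact Finset.sum_congr rfl (fun _ _ => Finset.sum_congr rfl fun _ _ => by ring)
    simp_rw [this]
    have hi : ∀ n m, IntervalIntegrable (fun s => c n * c m * (e n s * e m s)) volume 0 1 :=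
      fun n m => (continuous_const.mul ((he n).mul (he m))).intervalIntegrable _ _
    rw [intervalIntegral.integral_finsetSum]
    · refine Finset.sum_congr rfl (fun n hn => ?_)
      rw [intervalIntegral.integral_finsetSum (fun m _ => hi n m)]
      simp_rw [intervalIntegral.integral_const_mul, horth]
      simp [hn, sq]
    · intro n _
      exact (continuous_finsetSum _ fun m _ =>
        continuous_const.mul ((he n).mul (he m))).intervalIntegrable _ _
  have h3 : 0 ≤ ∫ s in (0:ℝ)..1, (f s ^ 2 - 2 * (f s * g s) + g s ^ 2) := by
    apply intervalIntegral.integral_nonneg (by norm_num)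
    intro s _
    nlinarith [sq_nonneg (f s - g s)]
  rw [intervalIntegral.integral_add (hf2.sub (hfg.const_mul 2)) hg2,
    intervalIntegral.integral_sub hf2 (hfg.const_mul 2), intervalIntegral.integral_const_mul,
    h1, h2] at h3
  linarith

lemma kd_l1 (x : ℕ+ → ℝ) (B : ℝ) (hB : ∀ S : Finset ℕ+, ∑ n ∈ S, x n ^ 2 ≤ B) :
    Summable (fun n : ℕ+ => |x n| / ((n : ℕ) : ℝ)) ∧
      ∑' n : ℕ+, |x n| / ((n : ℕ) : ℝ) ≤ Real.sqrt (B * (π ^ 2 / 6)) := by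
  have hB0 : 0 ≤ B := by simpa using hB ∅
  have hz := hasSum_zeta_two
  have hfin : ∀ S : Finset ℕ+, ∑ n ∈ S, (1 / ((n : ℕ) : ℝ)) ^ 2 ≤ π ^ 2 / 6 := by
    intro S
    have := sum_le_hasSum (S.map ⟨fun n : ℕ+ => (n : ℕ), PNat.coe_injective⟩)
      (fun i _ => by positivity) hz
    simpa using this
  have hle : ∀ S : Finset ℕ+, ∑ n ∈ S, |x n| / ((n : ℕ) : ℝ) ≤ Real.sqrt (B * (π ^ 2 / 6)) := by
    intro S
    apply Real.le_sqrt_of_sq_le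
    have h := Finset.sum_mul_sq_le_sq_mul_sq S (fun n => |x n|) (fun n => 1 / ((n : ℕ) : ℝ))
    simp only [sq_abs, mul_one_div] at h
    refine h.trans ?_
    apply mul_le_mul (hB S) (hfin S) (Finset.sum_nonneg fun _ _ => by positivity) hB0
  exact ⟨summable_of_sum_le (fun _ => by positivity) hle,
    Real.tsum_le_of_sum_le (fun _ => by positivity) hle⟩

lemma kd_int_cos (k : ℤ) : ∫ s in (0:ℝ)..1, Real.cos (k * π * s) = if k = 0 then 1 else 0 := by
  split_ifs with h
  · simp [h]
  · have hk : (k * π : ℝ) ≠ 0 := mul_ne_zero (by exact_mod_cast h) Real.pi_ne_zero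
    rw [intervalIntegral.integral_comp_mul_left (fun x => Real.cos x) hk]
    simp [Real.sin_int_mul_pi]

lemma kd_orth (n m : ℕ+) :
    (∫ s in (0:ℝ)..1, (Real.sqrt 2 * Real.cos (((n : ℕ) : ℝ) * π * s)) *
      (Real.sqrt 2 * Real.cos (((m : ℕ) : ℝ) * π * s)) = if n = m then 1 else 0) ∧
    (∫ s in (0:ℝ)..1, (Real.sqrt 2 * Real.sin (((n : ℕ) : ℝ) * π * s)) *
      (Real.sqrt 2 * Real.sin (((m : ℕ) : ℝ) * π * s)) = if n = m then 1 else 0) := by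
  have h2 : Real.sqrt 2 * Real.sqrt 2 = 2 := Real.mul_self_sqrt (by norm_num)
  have hA := kd_int_cos ((n : ℕ) - (m : ℕ) : ℤ)
  have hB := kd_int_cos ((n : ℕ) + (m : ℕ) : ℤ)
  have hn := n.pos
  rw [if_neg (by have := m.pos; omega)] at hB
  have hiff : (((n : ℕ) : ℤ) - ((m : ℕ) : ℤ) = 0) ↔ n = m := by
    rw [sub_eq_zero, Nat.cast_inj, PNat.coe_inj]
  simp only [hiff] at hA
  push_cast at hA hB
  have iA : IntervalIntegrable (fun s => Real.cos ((((n : ℕ) : ℝ) - ((m : ℕ) : ℝ)) * π * s))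
    volume 0 1 := Continuous.intervalIntegrable (by fun_prop) _ _
  have iB : IntervalIntegrable (fun s => Real.cos ((((n : ℕ) : ℝ) + ((m : ℕ) : ℝ)) * π * s))
    volume 0 1 := Continuous.intervalIntegrable (by fun_prop) _ _
  constructor
  · have : ∀ s : ℝ, (Real.sqrt 2 * Real.cos (((n : ℕ) : ℝ) * π * s)) *
      (Real.sqrt 2 * Real.cos (((m : ℕ) : ℝ) * π * s)) =
      Real.cos ((((n : ℕ) : ℝ) - ((m : ℕ) : ℝ)) * π * s) +
        Real.cos ((((n : ℕ) : ℝ) + ((m : ℕ) : ℝ)) * π * s) := by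
      intro s
      rw [sub_mul, sub_mul, add_mul, add_mul, Real.cos_sub, Real.cos_add]
      linear_combination (Real.cos (((n : ℕ) : ℝ) * π * s) * Real.cos (((m : ℕ) : ℝ) * π * s)) * h2
    simp_rw [this]
    rw [intervalIntegral.integral_add iA iB, hA, hB, add_zero]
  · have : ∀ s : ℝ, (Real.sqrt 2 * Real.sin (((n : ℕ) : ℝ) * π * s)) *
      (Real.sqrt 2 * Real.sin (((m : ℕ) : ℝ) * π * s)) =
      Real.cos ((((n : ℕ) : ℝ) - ((m : ℕ) : ℝ)) * π * s) -
        Real.cos ((((n : ℕ) : ℝ) + ((m : ℕ) : ℝ)) * π * s) := by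
      intro s
      rw [sub_mul, sub_mul, add_mul, add_mul, Real.cos_sub, Real.cos_add]
      linear_combination (Real.sin (((n : ℕ) : ℝ) * π * s) * Real.sin (((m : ℕ) : ℝ) * π * s)) * h2
    simp_rw [this]
    rw [intervalIntegral.integral_sub iA iB, hA, hB, sub_zero]

lemma kd_ibp (u du G G' : ℝ → ℝ) (hdu : IntervalIntegrable du volume 0 1)
    (hAC : ∀ x ∈ Icc (0:ℝ) 1, u x = ∫ s in (0:ℝ)..x, du s) (hb1 : u 1 = 0)
    (hG : ∀ x, HasDerivAt G (G' x) x) (hG' : Continuous G') :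
    ∫ s in (0:ℝ)..1, u s * G' s = - ∫ s in (0:ℝ)..1, du s * G s := by
  have hdG : deriv G = G' := funext fun x => (hG x).deriv
  have hGac : AbsolutelyContinuousOnInterval G 0 1 := by
    apply ContDiffOn.absolutelyContinuousOnInterval
    apply ContDiff.contDiffOn
    rw [contDiff_one_iff_deriv]
    exact ⟨fun x => (hG x).differentiableAt, by rw [hdG]; exact hG'⟩
  have h0 : (0:ℝ) ∈ uIcc (0:ℝ) 1 := by simp
  have hU := hdu.absolutelyContinuousOnInterval_intervalIntegral h0
  have key := hU.integral_mul_deriv_eq_deriv_mul hGac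
  have h1 : ∫ s in (0:ℝ)..1, du s = 0 := by
    rw [← hAC 1 (by simp)]; exact hb1
  rw [hdG, h1] at key
  have e1 : ∫ s in (0:ℝ)..1, u s * G' s = ∫ s in (0:ℝ)..1, (∫ v in (0:ℝ)..s, du v) * G' s := by
    apply intervalIntegral.integral_congr
    intro s hs
    rw [uIcc_of_le (by norm_num)] at hs
    simp only
    rw [hAC s hs]
  have e2 : ∫ s in (0:ℝ)..1, deriv (fun x => ∫ v in (0:ℝ)..x, du v) s * G s =
      ∫ s in (0:ℝ)..1, du s * G s := by
    apply intervalIntegral.integral_congr_ae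
    filter_upwards [hdu.ae_hasDerivAt_integral] with x hx hx'
    rw [(hx (uIoc_subset_uIcc hx') 0 h0).deriv]
  rw [e1, key, e2]
  simp

lemma kd_l1norm (u : ℝ → ℝ) (hu : Continuous u) :
    ∫ s in (0:ℝ)..1, |u s| ≤ L2norm u := by
  apply Real.le_sqrt_of_sq_le
  set m := ∫ s in (0:ℝ)..1, |u s| with hm
  have h3 : 0 ≤ ∫ s in (0:ℝ)..1, (u s ^ 2 - 2 * m * |u s| + m ^ 2) := by
    apply intervalIntegral.integral_nonneg (by norm_num)
    intro s _
    nlinarith [sq_nonneg (|u s| - m), sq_abs (u s)]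
  rw [intervalIntegral.integral_add, intervalIntegral.integral_sub,
    intervalIntegral.integral_const_mul, ← hm, intervalIntegral.integral_const] at h3
  · simp at h3
    nlinarith
  all_goals exact Continuous.intervalIntegrable (by fun_prop) _ _

lemma kd_H (u : ℝ → ℝ) (hu : Continuous u) :
    (∀ x, HasDerivAt (coleHopfH u) (-(1/2) * u x * coleHopfH u x) x) ∧
    (∀ x ∈ Icc (0:ℝ) 1, 0 ≤ coleHopfH u x ∧ coleHopfH u x ≤ Real.exp (L2norm u)) := by
  have hU : ∀ x, HasDerivAt (fun y => ∫ s in (0:ℝ)..y, u s) (u x) x := fun x =>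
    intervalIntegral.integral_hasDerivAt_right (hu.intervalIntegrable _ _)
      hu.stronglyMeasurable.stronglyMeasurableAtFilter hu.continuousAt
  have hUc : Continuous (fun y => ∫ s in (0:ℝ)..y, u s) :=
    continuous_iff_continuousAt.2 fun x => (hU x).continuousAt
  constructor
  · intro x
    have h := (((hU x).const_mul (-(1/2))).exp).div_const
      (∫ y in (0:ℝ)..1, Real.exp (-(1/2) * ∫ s in (0:ℝ)..y, u s))
    have h' : HasDerivAt (coleHopfH u) _ x := h
    refine h'.congr_deriv ?_
    simp only [coleHopfH]
    ring
  · set N := L2norm u with hN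
    have hUb : ∀ x ∈ Icc (0:ℝ) 1, |∫ s in (0:ℝ)..x, u s| ≤ N := by
      intro x hx
      calc |∫ s in (0:ℝ)..x, u s| ≤ ∫ s in (0:ℝ)..x, |u s| :=
            intervalIntegral.abs_integral_le_integral_abs hx.1
        _ ≤ ∫ s in (0:ℝ)..1, |u s| := by
            apply intervalIntegral.integral_mono_interval le_rfl hx.1 hx.2
            · exact Filter.Eventually.of_forall fun _ => abs_nonneg _
            · exact hu.abs.intervalIntegrable _ _
        _ ≤ N := kd_l1norm u hu
    have hZ : Real.exp (-(N/2)) ≤ ∫ y in (0:ℝ)..1, Real.exp (-(1/2) * ∫ s in (0:ℝ)..y, u s) := by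
      have : ∫ y in (0:ℝ)..1, Real.exp (-(N/2)) ≤
          ∫ y in (0:ℝ)..1, Real.exp (-(1/2) * ∫ s in (0:ℝ)..y, u s) := by
        apply intervalIntegral.integral_mono_on (by norm_num) (by simp)
          (Continuous.intervalIntegrable (by fun_prop) _ _)
        intro x hx
        apply Real.exp_le_exp.2
        have := (abs_le.1 (hUb x hx)).2
        linarith
      simpa using this
    have hZ0 := (Real.exp_pos (-(N/2))).trans_le hZ
    intro x hx
    unfold coleHopfH
    refine ⟨by positivity, ?_⟩
    rw [div_le_iff₀ hZ0]
    calc Real.exp (-(1/2) * ∫ s in (0:ℝ)..x, u s) ≤ Real.exp (N/2) := by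
          apply Real.exp_le_exp.2
          have := (abs_le.1 (hUb x hx)).1
          linarith
      _ = Real.exp N * Real.exp (-(N/2)) := by rw [← Real.exp_add]; congr 1; ring
      _ ≤ _ := by gcongr

lemma kd_coef (u du : ℝ → ℝ) (hu : Continuous u)
    (hdu : IntervalIntegrable du volume 0 1)
    (hAC : ∀ x ∈ Icc (0:ℝ) 1, u x = ∫ s in (0:ℝ)..x, du s) (hb1 : u 1 = 0) (n : ℕ+) :
    lCoef (n : ℕ) u = (1 / (2 * π)) *
      ((∫ s in (0:ℝ)..1, (u s * coleHopfH u s) * (Real.sqrt 2 * Real.sin (((n : ℕ) : ℝ) * π * s)))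
        / ((n : ℕ) : ℝ)) ∧
    ((n : ℕ) : ℝ) * lCoef (n : ℕ) u = (1 / (2 * π ^ 2)) *
      ((∫ s in (0:ℝ)..1, ((du s - u s ^ 2 / 2) * coleHopfH u s) *
        (Real.sqrt 2 * Real.cos (((n : ℕ) : ℝ) * π * s))) / ((n : ℕ) : ℝ)) := by
  obtain ⟨hv, -⟩ := kd_H u hu
  set v := coleHopfH u with hvdef
  have hvc : Continuous v := continuous_iff_continuousAt.2 fun x => (hv x).continuousAt
  have hn : ((n : ℕ) : ℝ) ≠ 0 := by exact_mod_cast n.pos.ne'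
  have hpi := Real.pi_ne_zero
  set k : ℝ := ((n : ℕ) : ℝ) * π with hk
  have hk0 : k ≠ 0 := mul_ne_zero hn hpi
  have hsin : ∀ x, HasDerivAt (fun y => Real.sin (k * y)) (k * Real.cos (k * x)) x := by
    intro x
    have := ((hasDerivAt_id x).const_mul k).sin
    simp only [id, mul_one] at this
    rw [mul_comm]; exact this
  have hcos : ∀ x, HasDerivAt (fun y => Real.cos (k * y)) (-(k * Real.sin (k * x))) x := by
    intro x
    have := ((hasDerivAt_id x).const_mul k).cos
    simp only [id, mul_one] at this
    convert this using 1; ring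
  have hsk : Real.sin k = 0 := Real.sin_nat_mul_pi _
  -- first integration by parts
  have h1 : k * ∫ s in (0:ℝ)..1, v s * Real.cos (k * s) =
      (1/2) * ∫ s in (0:ℝ)..1, u s * v s * Real.sin (k * s) := by
    have := intervalIntegral.integral_mul_deriv_eq_deriv_mul (a := 0) (b := 1)
      (fun x _ => hv x) (fun x _ => hsin x)
      (Continuous.intervalIntegrable (by fun_prop) _ _)
      (Continuous.intervalIntegrable (by fun_prop) _ _)
    simp only [mul_one, hsk, mul_zero, Real.sin_zero, sub_zero, zero_sub] at this
    rw [← intervalIntegral.integral_const_mul, ← intervalIntegral.integral_const_mul]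
    rw [← intervalIntegral.integral_neg] at this
    convert this using 2
    · ext s; ring
    · ext s; ring
  have h2 : k * ∫ s in (0:ℝ)..1, u s * v s * Real.sin (k * s) =
      ∫ s in (0:ℝ)..1, ((du s - u s ^ 2 / 2) * v s) * Real.cos (k * s) := by
    have := kd_ibp u du (fun s => v s * Real.cos (k * s))
      (fun x => -(1/2) * u x * v x * Real.cos (k * x) + v x * (-(k * Real.sin (k * x))))
      hdu hAC hb1 (fun x => (hv x).mul (hcos x)) (by fun_prop)
    have e : ∀ s, ((du s - u s ^ 2 / 2) * v s) * Real.cos (k * s) =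
      du s * (v s * Real.cos (k * s)) - u s ^ 2 / 2 * v s * Real.cos (k * s) := fun s => by ring
    simp_rw [e]
    have e' : ∀ s, u s * (-(1/2) * u s * v s * Real.cos (k * s) + v s * (-(k * Real.sin (k * s))))
      = -(u s ^ 2 / 2 * v s * Real.cos (k * s)) - k * (u s * v s * Real.sin (k * s)) :=
      fun s => by ring
    simp_rw [e'] at this
    rw [intervalIntegral.integral_sub (Continuous.intervalIntegrable (by fun_prop) _ _)
      (Continuous.intervalIntegrable (by fun_prop) _ _), intervalIntegral.integral_neg,
      intervalIntegral.integral_const_mul] at this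
    rw [intervalIntegral.integral_sub (hdu.mul_continuousOn
      (Continuous.continuousOn (by fun_prop)))
      (Continuous.intervalIntegrable (by fun_prop) _ _)]
    linarith
  have h3 : ∫ s in (0:ℝ)..1, (u s * v s) * (Real.sqrt 2 * Real.sin (k * s)) =
      Real.sqrt 2 * ∫ s in (0:ℝ)..1, u s * v s * Real.sin (k * s) := by
    rw [← intervalIntegral.integral_const_mul]; congr 1; ext s; ring
  have h4 : ∫ s in (0:ℝ)..1, ((du s - u s ^ 2 / 2) * v s) * (Real.sqrt 2 * Real.cos (k * s)) =
      Real.sqrt 2 * ∫ s in (0:ℝ)..1, ((du s - u s ^ 2 / 2) * v s) * Real.cos (k * s) := by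
    rw [← intervalIntegral.integral_const_mul]; congr 1; ext s; ring
  rw [h3, h4, ← h2]
  unfold lCoef cCoef
  rw [← hvdef, ← hk]
  have h1' : ∫ s in (0:ℝ)..1, v s * Real.cos (k * s) =
      (1/2) * (∫ s in (0:ℝ)..1, u s * v s * Real.sin (k * s)) / k := by
    rw [eq_div_iff hk0, ← h1]; ring
  rw [h1', hk]
  constructor <;> field_simp

lemma kd_main (u du : ℝ → ℝ) (hu : Continuous u)
    (hdu : IntervalIntegrable du volume 0 1)
    (hdu2 : IntervalIntegrable (fun s => du s ^ 2) volume 0 1)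
    (hAC : ∀ x ∈ Icc (0:ℝ) 1, u x = ∫ s in (0:ℝ)..x, du s) (hb1 : u 1 = 0)
    (hsm : 2 * Real.exp (L2norm u) * L2norm u < 1) :
    Summable (fun n : ℕ+ => |((n : ℕ) : ℝ) * lCoef (n : ℕ) u|) ∧
    Summable (fun n : ℕ+ => |lCoef (n : ℕ) u|) ∧
    Real.sqrt 2 * ∑' n : ℕ+, |lCoef (n : ℕ) u| < 1 := by
  obtain ⟨hv, hvb⟩ := kd_H u hu
  have hco := kd_coef u du hu hdu hAC hb1
  set v := coleHopfH u with hvdef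
  have hvc : Continuous v := continuous_iff_continuousAt.2 fun x => (hv x).continuousAt
  have hg : IntervalIntegrable (fun s => (du s - u s ^ 2 / 2) * v s) volume 0 1 := by
    apply IntervalIntegrable.mul_continuousOn _ hvc.continuousOn
    exact hdu.sub (Continuous.intervalIntegrable (by fun_prop) _ _)
  have hg2 : IntervalIntegrable (fun s => ((du s - u s ^ 2 / 2) * v s) ^ 2) volume 0 1 := by
    have e : (fun s => ((du s - u s ^ 2 / 2) * v s) ^ 2) =
      fun s => (du s ^ 2 - du s * u s ^ 2 + u s ^ 4 / 4) * v s ^ 2 := by ext s; ring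
    rw [e]
    apply IntervalIntegrable.mul_continuousOn _ (hvc.pow 2).continuousOn
    exact (hdu2.sub (hdu.mul_continuousOn (hu.pow 2).continuousOn)).add
      (Continuous.intervalIntegrable (by fun_prop) _ _)
  have b1 := kd_bessel (fun n s => Real.sqrt 2 * Real.sin (((n : ℕ) : ℝ) * π * s))
    (fun n => by fun_prop) (fun n m => (kd_orth n m).2) (fun s => u s * v s)
    (Continuous.intervalIntegrable (by fun_prop) _ _)
    (Continuous.intervalIntegrable (by fun_prop) _ _)
  have b2 := kd_bessel (fun n s => Real.sqrt 2 * Real.cos (((n : ℕ) : ℝ) * π * s))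
    (fun n => by fun_prop) (fun n m => (kd_orth n m).1) _ hg hg2
  obtain ⟨s1, t1⟩ := kd_l1 _ _ b1
  obtain ⟨s2, -⟩ := kd_l1 _ _ b2
  have hpi := Real.pi_pos
  have ea : ∀ n : ℕ+, |lCoef (n : ℕ) u| = (1 / (2 * π)) *
      (|∫ s in (0:ℝ)..1, (u s * v s) * (Real.sqrt 2 * Real.sin (((n : ℕ) : ℝ) * π * s))|
        / ((n : ℕ) : ℝ)) := by
    intro n
    rw [(hco n).1, abs_mul, abs_of_pos (by positivity : 0 < 1 / (2 * π)), abs_div, Nat.abs_cast]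
  have eb : ∀ n : ℕ+, |((n : ℕ) : ℝ) * lCoef (n : ℕ) u| = (1 / (2 * π ^ 2)) *
      (|∫ s in (0:ℝ)..1, ((du s - u s ^ 2 / 2) * v s) *
        (Real.sqrt 2 * Real.cos (((n : ℕ) : ℝ) * π * s))| / ((n : ℕ) : ℝ)) := by
    intro n
    rw [(hco n).2, abs_mul, abs_of_pos (by positivity : 0 < 1 / (2 * π ^ 2)), abs_div, Nat.abs_cast]
  simp_rw [ea, eb]
  refine ⟨s2.mul_left _, s1.mul_left _, ?_⟩
  rw [tsum_mul_left]
  set N := L2norm u with hN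
  have hN0 : 0 ≤ N := Real.sqrt_nonneg _
  have hN2 : N ^ 2 = ∫ s in (0:ℝ)..1, u s ^ 2 :=
    Real.sq_sqrt (intervalIntegral.integral_nonneg (by norm_num) fun _ _ => sq_nonneg _)
  have hI : ∫ s in (0:ℝ)..1, (u s * v s) ^ 2 ≤ (Real.exp N * N) ^ 2 := by
    rw [mul_pow, hN2, ← intervalIntegral.integral_const_mul]
    apply intervalIntegral.integral_mono_on (by norm_num)
      (Continuous.intervalIntegrable (by fun_prop) _ _)
      (Continuous.intervalIntegrable (by fun_prop) _ _)
    intro x hx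
    obtain ⟨h0, h1⟩ := hvb x hx
    rw [mul_pow, mul_comm]
    gcongr
  have hT : Real.sqrt ((∫ s in (0:ℝ)..1, (u s * v s) ^ 2) * (π ^ 2 / 6)) ≤ π / 4 := by
    apply Real.sqrt_le_iff.2 ⟨by positivity, ?_⟩
    have h12 : (Real.exp N * N) ^ 2 ≤ (1 / 2) ^ 2 := by
      have : 0 ≤ Real.exp N * N := by positivity
      apply pow_le_pow_left₀ this
      linarith
    have : 0 ≤ π ^ 2 := by positivity
    nlinarith
  have hs2 : Real.sqrt 2 ≤ 2 := Real.sqrt_le_iff.2 ⟨by norm_num, by norm_num⟩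
  have hT' := t1.trans hT
  calc _ ≤ Real.sqrt 2 * (1 / (2 * π) * (π / 4)) := by gcongr
    _ = Real.sqrt 2 / 8 := by field_simp; norm_num
    _ < 1 := by linarith

lemma kd_ext (u₀ du : ℝ → ℝ) (h : MemOmegaB u₀)
    (hdu_int : IntervalIntegrable du volume 0 1)
    (hdu_sq : IntervalIntegrable (fun s => du s ^ 2) volume 0 1)
    (hAC : ∀ x ∈ Icc (0:ℝ) 1, u₀ x = u₀ 0 + ∫ s in (0:ℝ)..x, du s)
    (hb0 : u₀ 0 = 0) (hb1 : u₀ 1 = 0) :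
    Summable (fun n : ℕ+ => |((n : ℕ) : ℝ) * lCoef (n : ℕ) u₀|) ∧
    Summable (fun n : ℕ+ => |lCoef (n : ℕ) u₀|) ∧
    Real.sqrt 2 * ∑' n : ℕ+, |lCoef (n : ℕ) u₀| < 1 := by
  have hAC' : ∀ x ∈ Icc (0:ℝ) 1, u₀ x = ∫ s in (0:ℝ)..x, du s := by
    intro x hx
    rw [hAC x hx, hb0, zero_add]
  have h01 : (0:ℝ) ≤ 1 := by norm_num
  have hcont : ContinuousOn u₀ (Icc 0 1) := by
    have hU := (hdu_int.absolutelyContinuousOnInterval_intervalIntegral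
      (c := 0) (by simp)).continuousOn
    rw [uIcc_of_le h01] at hU
    exact hU.congr hAC'
  set w : ℝ → ℝ := IccExtend h01 ((Icc (0:ℝ) 1).domRestrict u₀) with hw
  have hwc : Continuous w := (continuousOn_iff_continuous_domRestrict.1 hcont).Icc_extend'
  have hwe : ∀ x ∈ Icc (0:ℝ) 1, w x = u₀ x := by
    intro x hx
    rw [hw, IccExtend_of_mem h01 _ hx]
    rfl
  have hI : ∀ x ∈ Icc (0:ℝ) 1, ∫ s in (0:ℝ)..x, w s = ∫ s in (0:ℝ)..x, u₀ s := by
    intro x hx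
    apply intervalIntegral.integral_congr
    intro s hs
    rw [uIcc_of_le hx.1] at hs
    exact hwe s ⟨hs.1, hs.2.trans hx.2⟩
  have hL2 : L2norm w = L2norm u₀ := by
    unfold L2norm
    congr 1
    apply intervalIntegral.integral_congr
    intro s hs
    rw [uIcc_of_le h01] at hs
    simp only
    rw [hwe s hs]
  have hZ : ∫ y in (0:ℝ)..1, Real.exp (-(1/2) * ∫ s in (0:ℝ)..y, w s) =
      ∫ y in (0:ℝ)..1, Real.exp (-(1/2) * ∫ s in (0:ℝ)..y, u₀ s) := by
    apply intervalIntegral.integral_congr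
    intro s hs
    rw [uIcc_of_le h01] at hs
    simp only
    rw [hI s hs]
  have hl : ∀ n, lCoef n w = lCoef n u₀ := by
    intro n
    unfold lCoef cCoef
    congr 1
    apply intervalIntegral.integral_congr
    intro s hs
    rw [uIcc_of_le h01] at hs
    simp only [coleHopfH]
    rw [hI s hs, hZ]
  have := kd_main w du hwc hdu_int hdu_sq (fun x hx => by rw [hwe x hx, hAC' x hx])
    (by rw [hwe 1 (by simp), hb1]) (by rw [hL2]; exact h.2.2)
  simpa only [hl] using this

lemma kd_coe (l : List ℕ+) (g : ℕ → ℝ) :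
    List.map g (do let a ← l; pure (a : ℕ)) = l.map (fun k : ℕ+ => g (k : ℕ)) := by
  induction l with
  | nil => rfl
  | cons k l ih => simpa using ih

lemma kd_aIdx (ν : KoopIdx) (x : ℝ) : aIdx ν x =
  (-1 : ℝ) ^ ν.2.length * (2 : ℝ) ^ (((ν.2.length : ℝ) + 3) / 2) * ((ν.1 : ℕ) : ℝ) * π *
    Real.sin (((ν.1 : ℕ) : ℝ) * π * x) *
    (ν.2.map (fun k : ℕ+ => Real.cos (((k : ℕ) : ℝ) * π * x))).prod := by
  unfold aIdx
  rw [kd_coe]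

lemma kd_lamIdx (ν : KoopIdx) : lamIdx ν =
    -π ^ 2 * ((((ν.1 : ℕ) : ℝ)) ^ 2 + (ν.2.map (fun k : ℕ+ => (((k : ℕ) : ℝ)) ^ 2)).sum) := by
  unfold lamIdx
  rw [kd_coe]

lemma kd_phiIdx (u₀ : ℝ → ℝ) (ν : KoopIdx) : phiIdx u₀ ν =
    lCoef (ν.1 : ℕ) u₀ * (ν.2.map (fun k : ℕ+ => lCoef (k : ℕ) u₀)).prod := by
  unfold phiIdx
  rw [kd_coe]

lemma kd_point (u₀ : ℝ → ℝ) (t x : ℝ) (ν : KoopIdx) :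
    Real.exp (lamIdx ν * t) * phiIdx u₀ ν * aIdx ν x =
      (2 * (Real.exp (-((ν.1 : ℕ) : ℝ) ^ 2 * π ^ 2 * t) * lCoef (ν.1 : ℕ) u₀ *
        (Real.sqrt 2 * ((ν.1 : ℕ) : ℝ) * π * Real.sin (((ν.1 : ℕ) : ℝ) * π * x)))) *
      (ν.2.map (fun n : ℕ+ => -(Real.exp (-((n : ℕ) : ℝ) ^ 2 * π ^ 2 * t) * lCoef (n : ℕ) u₀ *
        (Real.sqrt 2 * Real.cos (((n : ℕ) : ℝ) * π * x))))).prod := by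
  obtain ⟨n, l⟩ := ν
  simp only [kd_lamIdx, kd_phiIdx, kd_aIdx]
  induction l with
  | nil =>
    have h32 : (2:ℝ) ^ (((([] : List ℕ+).length : ℝ) + 3) / 2) = 2 * Real.sqrt 2 := by
      rw [Real.sqrt_eq_rpow, ← Real.rpow_one_add' (by norm_num) (by norm_num)]
      norm_num
    rw [h32]
    have e : -π ^ 2 * (((n : ℕ) : ℝ) ^ 2 + 0) * t = -((n : ℕ) : ℝ) ^ 2 * π ^ 2 * t := by ring
    simp only [List.map_nil, List.sum_nil, List.prod_nil, List.length_nil, pow_zero]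
    rw [e]
    ring
  | cons k l ih =>
    have h2 : (2:ℝ) ^ ((((k :: l).length : ℝ) + 3) / 2) =
        (2:ℝ) ^ (((l.length : ℝ) + 3) / 2) * Real.sqrt 2 := by
      rw [Real.sqrt_eq_rpow, ← Real.rpow_add (by norm_num)]
      congr 1
      push_cast [List.length_cons]
      ring
    rw [h2]
    simp only [List.map_cons, List.sum_cons, List.prod_cons, List.length_cons, pow_succ (-1 : ℝ)]
    have e : Real.exp (-π ^ 2 * (((n : ℕ) : ℝ) ^ 2 + (((k : ℕ) : ℝ) ^ 2 +
        (l.map (fun k : ℕ+ => (((k : ℕ) : ℝ)) ^ 2)).sum)) * t) =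
      Real.exp (-((k : ℕ) : ℝ) ^ 2 * π ^ 2 * t) *
       Real.exp (-π ^ 2 * (((n : ℕ) : ℝ) ^ 2 + (l.map (fun k : ℕ+ => (((k : ℕ) : ℝ)) ^ 2)).sum) * t) := by
      rw [← Real.exp_add]; congr 1; ring
    rw [e]
    linear_combination (-(Real.exp (-((k : ℕ) : ℝ) ^ 2 * π ^ 2 * t) * lCoef (k : ℕ) u₀ *
        (Real.sqrt 2 * Real.cos (((k : ℕ) : ℝ) * π * x)))) * ih

lemma kd_list_abs_le {b β : ℕ+ → ℝ} (h : ∀ n, |b n| ≤ β n) (l : List ℕ+) :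
    |(l.map b).prod| ≤ (l.map β).prod := by
  induction l with
  | nil => simp
  | cons k l ih =>
    simp only [List.map_cons, List.prod_cons, abs_mul]
    exact mul_le_mul (h k) ih (abs_nonneg _) ((abs_nonneg _).trans (h k))

lemma kd_sq {ι : Type} {g : ι → ℝ} {a : ℝ} (h : Summable (fun i => |g i|)) (ha : HasSum g a) :
    HasSum (fun p : ι × ι => g p.1 * g p.2) (a ^ 2) := by
  have hn : Summable (fun i => ‖g i‖) := h
  rw [sq]
  exact ha.mul ha (summable_mul_of_summable_norm hn hn)

lemma kd_swap {ι : Type} [Countable ι] (f : ι → ℝ → ℝ) (M : ι → ℝ) (F : ℝ → ℝ)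
    (hM0 : ∀ ν, 0 ≤ M ν) (hMs : Summable M) (hfM : ∀ ν x, |f ν x| ≤ M ν)
    (hfc : ∀ ν, Continuous (f ν)) (hfsum : ∀ x, HasSum (fun ν => f ν x) (F x)) :
    HasSum (fun p : ι × ι => ∫ s in (0:ℝ)..1, f p.1 s * f p.2 s)
      (∫ s in (0:ℝ)..1, F s ^ 2) := by
  have hMM : Summable (fun p : ι × ι => M p.1 * M p.2) :=
    hMs.mul_of_nonneg hMs hM0 hM0
  apply intervalIntegral.hasSum_integral_of_dominated_convergence
    (fun p _ => M p.1 * M p.2)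
  · intro p
    exact ((hfc p.1).mul (hfc p.2)).aestronglyMeasurable
  · intro p
    refine Filter.Eventually.of_forall fun x _ => ?_
    rw [Real.norm_eq_abs, abs_mul]
    exact mul_le_mul (hfM _ _) (hfM _ _) (abs_nonneg _) (hM0 _)
  · exact Filter.Eventually.of_forall fun x _ => hMM
  · exact intervalIntegrable_const
  · refine Filter.Eventually.of_forall fun x _ => ?_
    exact kd_sq (Summable.of_nonneg_of_le (fun _ => abs_nonneg _) (fun ν => hfM ν x) hMs) (hfsum x)

/-- **Koopman decomposition of the kinetic energy.** For `u₀ ∈ ω_B`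
(i.e. `u₀ ∈ Ω_B` absolutely continuous with weak derivative `du ∈ L²([0,1])` and
`u₀(0) = u₀(1) = 0`) and `t ≥ 0`, the family
`(e^{(λ_ν+λ_{ν'})t} φ_ν(u₀) φ_{ν'}(u₀) ∫₀¹ a_ν a_{ν'})_{(ν,ν')}` is summable and its sum is
the kinetic energy `E(u(t,·)) = ∫₀¹ u(t,s)² ds` of the Burgers evolution of `u₀`. -/
theorem koopman_decomposition_energy (u₀ du : ℝ → ℝ) (h : MemOmegaB u₀)
    (hdu_int : IntervalIntegrable du volume 0 1)
    (hdu_sq : IntervalIntegrable (fun s => du s ^ 2) volume 0 1)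
    (hAC : ∀ x ∈ Icc (0:ℝ) 1, u₀ x = u₀ 0 + ∫ s in (0:ℝ)..x, du s)
    (hb0 : u₀ 0 = 0) (hb1 : u₀ 1 = 0)
    (t : ℝ) (ht : 0 ≤ t) :
    Summable (fun p : KoopIdx × KoopIdx =>
      Real.exp ((lamIdx p.1 + lamIdx p.2) * t) * phiIdx u₀ p.1 * phiIdx u₀ p.2 *
        ∫ s in (0:ℝ)..1, aIdx p.1 s * aIdx p.2 s) ∧
    (∑' p : KoopIdx × KoopIdx,
      Real.exp ((lamIdx p.1 + lamIdx p.2) * t) * phiIdx u₀ p.1 * phiIdx u₀ p.2 *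
        ∫ s in (0:ℝ)..1, aIdx p.1 s * aIdx p.2 s) =
      ∫ s in (0:ℝ)..1, burgersU u₀ t s ^ 2 := by
  obtain ⟨hs1, hs0, hlt⟩ := kd_ext u₀ du h hdu_int hdu_sq hAC hb0 hb1
  have hr2 : 0 ≤ Real.sqrt 2 := Real.sqrt_nonneg _
  have hpi := Real.pi_pos
  -- the functions entering the expansion
  set b : ℝ → ℕ+ → ℝ := fun x n =>
    -(Real.exp (-((n : ℕ) : ℝ) ^ 2 * π ^ 2 * t) * lCoef (n : ℕ) u₀ *
        (Real.sqrt 2 * Real.cos (((n : ℕ) : ℝ) * π * x))) with hb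
  set c : ℝ → ℕ+ → ℝ := fun x n =>
    2 * (Real.exp (-((n : ℕ) : ℝ) ^ 2 * π ^ 2 * t) * lCoef (n : ℕ) u₀ *
        (Real.sqrt 2 * ((n : ℕ) : ℝ) * π * Real.sin (((n : ℕ) : ℝ) * π * x))) with hc
  set β : ℕ+ → ℝ := fun n => Real.sqrt 2 * |lCoef (n : ℕ) u₀| with hβ
  set γ : ℕ+ → ℝ := fun n => 2 * Real.sqrt 2 * π * |((n : ℕ) : ℝ) * lCoef (n : ℕ) u₀| with hγ
  have hexp : ∀ n : ℕ+, Real.exp (-((n : ℕ) : ℝ) ^ 2 * π ^ 2 * t) ≤ 1 := by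
    intro n
    apply Real.exp_le_one_iff.2
    have : 0 ≤ ((n : ℕ) : ℝ) ^ 2 * π ^ 2 * t := by positivity
    linarith
  have hbβ : ∀ x n, |b x n| ≤ β n := by
    intro x n
    simp only [hb, hβ, abs_neg, abs_mul, abs_of_nonneg hr2, Real.abs_exp]
    calc _ ≤ 1 * |lCoef (n : ℕ) u₀| * (Real.sqrt 2 * 1) := by
          gcongr
          · exact hexp n
          · exact Real.abs_cos_le_one _
      _ = _ := by ring
  have hcγ : ∀ x n, |c x n| ≤ γ n := by
    intro x n
    simp only [hc, hγ, abs_mul, abs_of_nonneg hr2, Real.abs_exp, Nat.abs_cast, abs_of_pos hpi,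
      abs_two]
    calc _ ≤ 2 * (1 * |lCoef (n : ℕ) u₀| * (Real.sqrt 2 * ((n : ℕ) : ℝ) * π * 1)) := by
          gcongr
          · exact hexp n
          · exact Real.abs_sin_le_one _
      _ = _ := by ring
  have hβ0 : ∀ n, 0 ≤ β n := fun n => by positivity
  have hγ0 : ∀ n, 0 ≤ γ n := fun n => by positivity
  have hβs : Summable β := hs0.mul_left _
  have hγs : Summable γ := hs1.mul_left _
  have hβlt : ∑' n, β n < 1 := by rw [hβ, tsum_mul_left]; exact hlt
  have hβabs : (fun n => |β n|) = β := funext fun n => abs_of_nonneg (hβ0 n)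
  have hbs : ∀ x, Summable (fun n => |b x n|) := fun x =>
    Summable.of_nonneg_of_le (fun _ => abs_nonneg _) (hbβ x) hβs
  have hcs : ∀ x, Summable (fun n => |c x n|) := fun x =>
    Summable.of_nonneg_of_le (fun _ => abs_nonneg _) (hcγ x) hγs
  have hblt : ∀ x, ∑' n, |b x n| < 1 := fun x =>
    ((hbs x).tsum_le_tsum (hbβ x) hβs).trans_lt hβlt
  have hP0 : ∀ l : List ℕ+, 0 ≤ (l.map β).prod := fun l =>
    (abs_nonneg _).trans (kd_list_abs_le (fun n => (abs_of_nonneg (hβ0 n)).le) l)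
  have hPs : Summable (fun l : List ℕ+ => (l.map β).prod) := by
    refine (kd_list (b := β) ?_ ?_).1.of_abs
    · rw [hβabs]; exact hβs
    · rw [hβabs]; exact hβlt
  set M : KoopIdx → ℝ := fun ν => γ ν.1 * (ν.2.map β).prod with hM
  have hM0 : ∀ ν, 0 ≤ M ν := fun ν => mul_nonneg (hγ0 _) (hP0 _)
  have hMs : Summable M := hγs.mul_of_nonneg hPs hγ0 hP0
  set f : KoopIdx → ℝ → ℝ := fun ν x =>
    Real.exp (lamIdx ν * t) * phiIdx u₀ ν * aIdx ν x with hf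
  have hfe : ∀ ν x, f ν x = c x ν.1 * (ν.2.map (b x)).prod := fun ν x => kd_point u₀ t x ν
  have hfM : ∀ ν x, |f ν x| ≤ M ν := by
    intro ν x
    rw [hfe, abs_mul]
    exact mul_le_mul (hcγ x _) (kd_list_abs_le (hbβ x) _) (abs_nonneg _) (hγ0 _)
  have hfc : ∀ ν, Continuous (f ν) := by
    intro ν
    have : Continuous (fun x => (ν.2.map (fun k : ℕ+ => Real.cos (((k : ℕ) : ℝ) * π * x))).prod) :=
      continuous_list_prod ν.2 (fun k _ => by fun_prop)
    simp only [hf, kd_aIdx]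
    fun_prop
  have hfs : ∀ x, Summable (fun ν => |f ν x|) := fun x =>
    Summable.of_nonneg_of_le (fun _ => abs_nonneg _) (fun ν => hfM ν x) hMs
  have hfsum : ∀ x, HasSum (fun ν => f ν x) (burgersU u₀ t x) := by
    intro x
    obtain ⟨hl1, hl2⟩ := kd_list (hbs x) (hblt x)
    have hval : ∑' ν, f ν x = burgersU u₀ t x := by
      simp_rw [hfe]
      have hc' : Summable (fun n => ‖c x n‖) := hcs x
      have hl' : Summable (fun l : List ℕ+ => ‖(l.map (b x)).prod‖) := hl1
      rw [← tsum_mul_tsum_of_summable_norm hc' hl', hl2.tsum_eq]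
      simp only [burgersU, heatV, heatVx, hb, hc, tsum_neg, tsum_mul_left]
      rw [div_eq_mul_inv, sub_neg_eq_add]
      ring
    rw [← hval]
    exact (hfs x).of_abs.hasSum
  have main : HasSum (fun p : KoopIdx × KoopIdx => ∫ s in (0:ℝ)..1, f p.1 s * f p.2 s)
      (∫ s in (0:ℝ)..1, burgersU u₀ t s ^ 2) :=
    kd_swap f M (burgersU u₀ t) hM0 hMs hfM hfc hfsum
  have hterm : ∀ p : KoopIdx × KoopIdx, ∫ s in (0:ℝ)..1, f p.1 s * f p.2 s =
      Real.exp ((lamIdx p.1 + lamIdx p.2) * t) * phiIdx u₀ p.1 * phiIdx u₀ p.2 *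
        ∫ s in (0:ℝ)..1, aIdx p.1 s * aIdx p.2 s := by
    intro p
    rw [← intervalIntegral.integral_const_mul]
    congr 1
    ext s
    simp only [hf]
    rw [add_mul, Real.exp_add]
    ring
  simp_rw [hterm] at main
  exact ⟨main.summable, main.tsum_eq⟩
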